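/- arXiv:1603.09220 — 8 statements merged into one kernel-verified Lean document; each statement's English description precedes it below -/
import Mathlib

section
/- Let 0 < θ < π/2 and ε > 0. For every λ ∈ Σ_{π−θ} with arg λ ≥ 0 and every z ∈ Σ_{θ/2}, setting λ_ε := ε + λ and ω := √(λ_ε + z²) (principal square root), the numbers λ_ε + z, λ_ε + z², ω and ω + z are all nonzero and satisfy: −θ < arg(λ_ε + z) < π − θ, −θ < arg(λ_ε + z²) < π − θ, −θ/2 < arg ω < π/2 − θ/2, and −θ/2 < arg(ω + z) < π/2 − θ/2. -/
/-- The open sector `Σ_ψ` of half-opening angle `ψ` around the positive real axis. -/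
def sector (ψ : ℝ) : Set ℂ := {w : ℂ | w ≠ 0 ∧ |w.arg| < ψ}

theorem P_iff (a : ℝ) (ha : 0 < a) (ha' : a < Real.pi) (w : ℂ) :
    0 < w.re * Real.sin a + w.im * Real.cos a ↔
      (w ≠ 0 ∧ -a < w.arg ∧ w.arg < Real.pi - a) := by
  have key : w.re * Real.sin a + w.im * Real.cos a = ‖w‖ * Real.sin (w.arg + a) := by
    rw [Real.sin_add]
    nth_rewrite 1 [← Complex.norm_mul_cos_arg w]
    nth_rewrite 1 [← Complex.norm_mul_sin_arg w]
    ring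
  have h1 := Complex.neg_pi_lt_arg w
  have h2 := Complex.arg_le_pi w
  rw [key]
  constructor
  · intro h
    have hw : w ≠ 0 := by
      rintro rfl
      simp at h
    have hs : 0 < Real.sin (w.arg + a) := by
      have := norm_pos_iff.mpr hw
      exact (mul_pos_iff_of_pos_left this).mp h
    refine ⟨hw, ?_, ?_⟩
    · by_contra hc
      have := Real.sin_nonpos_of_nonpos_of_neg_pi_le (x := w.arg + a) (by linarith) (by linarith)
      linarith
    · by_contra hc
      have := Real.sin_nonneg_of_nonneg_of_le_pi (x := w.arg + a - Real.pi)
        (by linarith) (by linarith)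
      rw [Real.sin_sub_pi] at this
      linarith
  · rintro ⟨hw, h3, h4⟩
    exact mul_pos (norm_pos_iff.mpr hw)
      (Real.sin_pos_of_pos_of_lt_pi (by linarith) (by linarith))

theorem arg_sqrt (w : ℂ) (hw : w ≠ 0) : (w ^ (1/2 : ℂ)).arg = w.arg / 2 := by
  have h1 := Complex.neg_pi_lt_arg w
  have h2 := Complex.arg_le_pi w
  have hp := Real.pi_pos
  have him : (Complex.log w * (1/2 : ℂ)).im = w.arg / 2 := by
    have : (1/2 : ℂ) = ((1/2 : ℝ) : ℂ) := by push_cast; rfl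
    rw [this, Complex.im_mul_ofReal, Complex.log_im]
    ring
  rw [Complex.cpow_def_of_ne_zero hw, ← Complex.log_im, Complex.log_exp, him]
  · rw [him]; linarith
  · rw [him]; linarith

/-- For `0 < θ < π/2`, `ε > 0`, `λ ∈ Σ_{π-θ}` with `arg λ ≥ 0` and `z ∈ Σ_{θ/2}`,
setting `λ_ε = ε + λ` and `ω = √(λ_ε + z²)` (principal branch), the quantities
`λ_ε + z`, `λ_ε + z²`, `ω` and `ω + z` are nonzero and satisfy the stated
argument bounds. -/
theorem sector_arg_bounds (θ ε : ℝ) (hθ₀ : 0 < θ) (hθ₁ : θ < Real.pi / 2) (hε : 0 < ε)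
    (l z : ℂ) (hl : l ∈ sector (Real.pi - θ)) (hl0 : 0 ≤ l.arg) (hz : z ∈ sector (θ / 2)) :
    let lε : ℂ := (ε : ℂ) + l
    let ω : ℂ := (lε + z ^ 2) ^ (1/2 : ℂ)
    lε + z ≠ 0 ∧ lε + z ^ 2 ≠ 0 ∧ ω ≠ 0 ∧ ω + z ≠ 0 ∧
      (-θ < (lε + z).arg ∧ (lε + z).arg < Real.pi - θ) ∧
      (-θ < (lε + z ^ 2).arg ∧ (lε + z ^ 2).arg < Real.pi - θ) ∧
      (-(θ / 2) < ω.arg ∧ ω.arg < Real.pi / 2 - θ / 2) ∧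
      (-(θ / 2) < (ω + z).arg ∧ (ω + z).arg < Real.pi / 2 - θ / 2) := by
  intro lε ω
  obtain ⟨hl1, hl2⟩ := hl
  obtain ⟨hz1, hz2⟩ := hz
  rw [abs_lt] at hl2 hz2
  have hp := Real.pi_pos
  have H1 := P_iff θ hθ₀ (by linarith)
  have H2 := P_iff (θ / 2) (by linarith) (by linarith)
  have H3 := P_iff (θ / 2 + Real.pi / 2) (by linarith) (by linarith)
  rw [Real.sin_add_pi_div_two, Real.cos_add_pi_div_two] at H3
  have hs : 0 < Real.sin θ := Real.sin_pos_of_pos_of_lt_pi hθ₀ (by linarith)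
  have l1 := (H1 l).2 ⟨hl1, by linarith, by linarith⟩
  have z1 := (H1 z).2 ⟨hz1, by linarith, by linarith⟩
  have z2 := (H2 z).2 ⟨hz1, by linarith, by linarith⟩
  have z3 := (H3 z).2 ⟨hz1, by linarith, by linarith⟩
  have zz : 0 < (z ^ 2).re * Real.sin θ + (z ^ 2).im * Real.cos θ := by
    have e : θ = 2 * (θ / 2) := by ring
    have e1 : Real.sin θ = 2 * Real.sin (θ / 2) * Real.cos (θ / 2) := by
      rw [← Real.sin_two_mul, ← e]
    have e2 : Real.cos θ = Real.cos (θ / 2) ^ 2 - Real.sin (θ / 2) ^ 2 := by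
      rw [← Real.cos_two_mul', ← e]
    rw [e1, e2, pow_two z, Complex.mul_re, Complex.mul_im]
    have := mul_pos z2 z3
    linarith
  have a1 : 0 < (lε + z).re * Real.sin θ + (lε + z).im * Real.cos θ := by
    have := mul_pos hε hs
    simp only [lε, Complex.add_re, Complex.add_im, Complex.ofReal_re, Complex.ofReal_im]
    linarith
  have a2 : 0 < (lε + z ^ 2).re * Real.sin θ + (lε + z ^ 2).im * Real.cos θ := by
    have := mul_pos hε hs
    simp only [lε, Complex.add_re, Complex.add_im, Complex.ofReal_re, Complex.ofReal_im]
    linarith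
  obtain ⟨b1, b2⟩ := (H1 _).1 a1
  obtain ⟨c1, c2, c3⟩ := (H1 _).1 a2
  have w0 : ω ≠ 0 := by
    simp only [ω]
    rw [Complex.cpow_def_of_ne_zero c1]
    exact Complex.exp_ne_zero _
  have wa : ω.arg = (lε + z ^ 2).arg / 2 := arg_sqrt _ c1
  have w2 := (H2 ω).2 ⟨w0, by linarith, by linarith⟩
  have w3 := (H3 ω).2 ⟨w0, by linarith, by linarith⟩
  obtain ⟨d1, d2, _⟩ := (H2 (ω + z)).1 (by
    rw [Complex.add_re, Complex.add_im]; linarith)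
  obtain ⟨_, _, d3⟩ := (H3 (ω + z)).1 (by
    rw [Complex.add_re, Complex.add_im]; linarith)
  exact ⟨b1, c1, w0, d1, b2, ⟨c2, c3⟩, ⟨by linarith, by linarith⟩, d2, by linarith⟩
end

section
/- Let 0 < θ < π/2, ε > 0, and let α, R, κ > 0 be real parameters. For every λ ∈ Σ_{π−θ} with arg λ ≥ 0 and every z ∈ Σ_{θ/2}, setting λ_ε := ε + λ and ω := √(λ_ε + z²), the following argument bounds hold: −π + θ/2 < arg( Rκ(ω + z) / (α√R·λ_ε) ) < π/2 − θ/2; −π/2 − θ/2 < arg( (α√R·λ_ε + Rκz) / (Rκω) ) < π − θ/2; and −3θ/2 < arg( (α√R·λ_ε + Rκω) / (Rκz) ) < π − θ/2. In particular each of these three quotients is well defined and nonzero. -/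
/-- Polar representation with angle `t`. -/
def HasAngle (w : ℂ) (t : ℝ) : Prop := ∃ r : ℝ, 0 < r ∧ w = (r : ℂ) * Complex.exp ((t : ℂ) * Complex.I)

theorem HasAngle.ne_zero {w : ℂ} {t : ℝ} (h : HasAngle w t) : w ≠ 0 := by
  obtain ⟨r, hr, rfl⟩ := h
  exact mul_ne_zero (by exact_mod_cast hr.ne') (Complex.exp_ne_zero _)

theorem HasAngle.of_arg {w : ℂ} (h : w ≠ 0) : HasAngle w w.arg :=
  ⟨‖w‖, norm_pos_iff.mpr h, (Complex.norm_mul_exp_arg_mul_I w).symm⟩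

theorem HasAngle.of_pos {x : ℝ} (h : 0 < x) : HasAngle (x : ℂ) 0 := ⟨x, h, by simp⟩

theorem HasAngle.arg_eq {w : ℂ} {t : ℝ} (h : HasAngle w t) (h1 : -Real.pi < t)
    (h2 : t ≤ Real.pi) : w.arg = t := by
  obtain ⟨r, hr, rfl⟩ := h
  rw [Complex.exp_mul_I]
  exact Complex.arg_mul_cos_add_sin_mul_I hr ⟨h1, h2⟩

theorem HasAngle.mul {w v : ℂ} {s t : ℝ} (h : HasAngle w s) (h' : HasAngle v t) :
    HasAngle (w * v) (s + t) := by
  obtain ⟨r, hr, rfl⟩ := h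
  obtain ⟨q, hq, rfl⟩ := h'
  refine ⟨r * q, mul_pos hr hq, ?_⟩
  push_cast
  rw [add_mul, Complex.exp_add]
  ring

theorem HasAngle.div {w v : ℂ} {s t : ℝ} (h : HasAngle w s) (h' : HasAngle v t) :
    HasAngle (w / v) (s - t) := by
  obtain ⟨r, hr, rfl⟩ := h
  obtain ⟨q, hq, rfl⟩ := h'
  refine ⟨r / q, div_pos hr hq, ?_⟩
  push_cast
  rw [sub_mul, Complex.exp_sub, mul_div_mul_comm]

theorem HasAngle.sqrt {w : ℂ} {t : ℝ} (h : HasAngle w t) (h1 : -Real.pi < t)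
    (h2 : t ≤ Real.pi) : HasAngle (w ^ (1/2 : ℂ)) (t / 2) := by
  refine ⟨Real.exp (Real.log ‖w‖ / 2), Real.exp_pos _, ?_⟩
  rw [Complex.cpow_def_of_ne_zero h.ne_zero, Complex.log, h.arg_eq h1 h2]
  push_cast
  rw [← Complex.exp_add]
  congr 1
  ring

theorem HasAngle.add_aux {w v : ℂ} {s t : ℝ} (h : HasAngle w s) (h' : HasAngle v t)
    (hst : s ≤ t) (hts : t - s < Real.pi) : ∃ u, s ≤ u ∧ u ≤ t ∧ HasAngle (w + v) u := by
  rcases hst.eq_or_lt with rfl | hlt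
  · obtain ⟨r, hr, rfl⟩ := h
    obtain ⟨q, hq, rfl⟩ := h'
    exact ⟨s, le_rfl, le_rfl, r + q, add_pos hr hq, by push_cast; ring⟩
  obtain ⟨r, hr, rfl⟩ := h
  obtain ⟨q, hq, rfl⟩ := h'
  have hsin : 0 < Real.sin (t - s) := Real.sin_pos_of_pos_of_lt_pi (by linarith) hts
  set u : ℂ := r + q * Complex.exp (((t - s : ℝ) : ℂ) * Complex.I) with hu
  have him : u.im = q * Real.sin (t - s) := by
    rw [hu, Complex.add_im, Complex.im_ofReal_mul, Complex.exp_ofReal_mul_I_im, Complex.ofReal_im, zero_add]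
  have hre : u.re = r + q * Real.cos (t - s) := by
    rw [hu, Complex.add_re, Complex.re_ofReal_mul, Complex.exp_ofReal_mul_I_re, Complex.ofReal_re]
  have him0 : 0 < u.im := by rw [him]; positivity
  have hu0 : u ≠ 0 := by
    intro h0
    rw [h0] at him0
    simp at him0
  have ha0 : 0 ≤ u.arg := Complex.arg_nonneg_iff.mpr him0.le
  have hn : 0 < ‖u‖ := norm_pos_iff.mpr hu0
  have hle : u.arg ≤ t - s := by
    by_contra hcon
    push Not at hcon
    have hp : 0 < Real.sin (u.arg - (t - s)) :=
      Real.sin_pos_of_pos_of_lt_pi (by linarith) (by linarith [Complex.arg_le_pi u])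
    have e1 : ‖u‖ * Real.sin (u.arg - (t - s)) = - (r * Real.sin (t - s)) := by
      rw [Real.sin_sub]
      have c1 := Complex.norm_mul_cos_arg u
      have c2 := Complex.norm_mul_sin_arg u
      rw [him] at c2
      rw [hre] at c1
      linear_combination Real.cos (t - s) * c2 - Real.sin (t - s) * c1
    have : 0 < r * Real.sin (t - s) := by positivity
    have : 0 < ‖u‖ * Real.sin (u.arg - (t - s)) := by positivity
    linarith
  refine ⟨s + u.arg, by linarith, by linarith, ?_⟩
  have e : HasAngle (Complex.exp ((s : ℂ) * Complex.I)) s := ⟨1, one_pos, by simp⟩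
  have := e.mul (HasAngle.of_arg hu0)
  convert this using 1
  rw [hu, mul_add, mul_left_comm, ← Complex.exp_add]
  push_cast
  ring_nf

theorem HasAngle.add {w v : ℂ} {s t : ℝ} (h : HasAngle w s) (h' : HasAngle v t)
    (hst : s - t < Real.pi) (hts : t - s < Real.pi) :
    ∃ u, min s t ≤ u ∧ u ≤ max s t ∧ HasAngle (w + v) u := by
  rcases le_total s t with hle | hle
  · simpa [hle] using h.add_aux h' hle hts
  · rw [add_comm]
    simpa [hle] using h'.add_aux h hle hst

theorem HasAngle.add_Ioo {w v : ℂ} {s t A B : ℝ} (h : HasAngle w s) (h' : HasAngle v t)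
    (hAB : B - A ≤ Real.pi) (h1 : A < s) (h2 : s < B) (h3 : A < t) (h4 : t < B) :
    ∃ u, A < u ∧ u < B ∧ HasAngle (w + v) u := by
  obtain ⟨u, a, b, c⟩ := h.add h' (by linarith) (by linarith)
  exact ⟨u, (lt_min h1 h3).trans_le a, b.trans_lt (max_lt h2 h4), c⟩

theorem HasAngle.smul_pos {w : ℂ} {t : ℝ} (h : HasAngle w t) {c : ℝ} (hc : 0 < c) :
    HasAngle ((c : ℂ) * w) t := by
  simpa using (HasAngle.of_pos hc).mul h

theorem HasAngle.concl {w : ℂ} {t A B : ℝ} (h : HasAngle w t) (h1 : -Real.pi ≤ A)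
    (h2 : B ≤ Real.pi) (h3 : A < t) (h4 : t < B) : w ≠ 0 ∧ A < w.arg ∧ w.arg < B := by
  rw [h.arg_eq (by linarith) (by linarith)]
  exact ⟨h.ne_zero, h3, h4⟩

/-- Argument bounds for the three quotients `w_j` (with `m_j⁻¹ = 1 + w_j`) appearing in the
analysis of the boundary symbol for the tangentially dynamic outflow condition. -/
theorem symbol_quotient_arg_bounds (θ ε α R κ : ℝ)
    (hθ₀ : 0 < θ) (hθ₁ : θ < Real.pi / 2) (hε : 0 < ε)
    (hα : 0 < α) (hR : 0 < R) (hκ : 0 < κ)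
    (l z : ℂ) (hl : l ∈ sector (Real.pi - θ)) (hl0 : 0 ≤ l.arg) (hz : z ∈ sector (θ / 2)) :
    let lε : ℂ := (ε : ℂ) + l
    let ω : ℂ := (lε + z ^ 2) ^ (1/2 : ℂ)
    let a : ℂ := (α : ℂ) * (Real.sqrt R : ℂ) * lε
    ((R : ℂ) * (κ : ℂ) * (ω + z) / a ≠ 0 ∧
      -Real.pi + θ / 2 < ((R : ℂ) * (κ : ℂ) * (ω + z) / a).arg ∧
      ((R : ℂ) * (κ : ℂ) * (ω + z) / a).arg < Real.pi / 2 - θ / 2) ∧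
    ((a + (R : ℂ) * (κ : ℂ) * z) / ((R : ℂ) * (κ : ℂ) * ω) ≠ 0 ∧
      -(Real.pi / 2) - θ / 2 < ((a + (R : ℂ) * (κ : ℂ) * z) / ((R : ℂ) * (κ : ℂ) * ω)).arg ∧
      ((a + (R : ℂ) * (κ : ℂ) * z) / ((R : ℂ) * (κ : ℂ) * ω)).arg < Real.pi - θ / 2) ∧
    ((a + (R : ℂ) * (κ : ℂ) * ω) / ((R : ℂ) * (κ : ℂ) * z) ≠ 0 ∧
      -(3 * θ / 2) < ((a + (R : ℂ) * (κ : ℂ) * ω) / ((R : ℂ) * (κ : ℂ) * z)).arg ∧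
      ((a + (R : ℂ) * (κ : ℂ) * ω) / ((R : ℂ) * (κ : ℂ) * z)).arg < Real.pi - θ / 2) := by
  intro lε ω a
  obtain ⟨hl1, hl2⟩ := hl
  obtain ⟨hz1, hz2⟩ := hz
  obtain ⟨hz2, hz3⟩ := abs_lt.mp hz2
  have hl3 := (abs_lt.mp hl2).2
  have Hz := HasAngle.of_arg hz1
  obtain ⟨p, hp0, hp1, Hp⟩ : ∃ p, 0 ≤ p ∧ p ≤ l.arg ∧ HasAngle lε p :=
    (HasAngle.of_pos hε).add_aux (HasAngle.of_arg hl1) hl0 (by linarith)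
  have Hz2 : HasAngle (z ^ 2) (z.arg + z.arg) := by rw [pow_two]; exact Hz.mul Hz
  obtain ⟨q, hq0, hq1, Hq⟩ := Hp.add_Ioo Hz2 (A := -θ) (B := Real.pi - θ) (by linarith)
    (by linarith) (by linarith) (by linarith) (by linarith)
  have Hω : HasAngle ω (q / 2) := Hq.sqrt (by linarith) (by linarith)
  have Ha : HasAngle a p := by
    have := Hp.smul_pos (mul_pos hα (Real.sqrt_pos.mpr hR))
    push_cast at this
    exact this
  have sm : ∀ {w : ℂ} {t : ℝ}, HasAngle w t → HasAngle ((R : ℂ) * (κ : ℂ) * w) t := by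
    intro w t h
    have := h.smul_pos (mul_pos hR hκ)
    push_cast at this
    exact this
  refine ⟨?_, ?_, ?_⟩
  · obtain ⟨u, hu0, hu1, Hu⟩ := Hω.add_Ioo Hz (A := -θ / 2) (B := Real.pi / 2 - θ / 2)
      (by linarith) (by linarith) (by linarith) (by linarith) (by linarith)
    exact ((sm Hu).div Ha).concl (by linarith) (by linarith) (by linarith) (by linarith)
  · obtain ⟨u, hu0, hu1, Hu⟩ := Ha.add_Ioo (sm Hz) (A := -θ / 2) (B := Real.pi - θ)
      (by linarith) (by linarith) (by linarith) (by linarith) (by linarith)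
    exact (Hu.div (sm Hω)).concl (by linarith) (by linarith) (by linarith) (by linarith)
  · obtain ⟨u, hu0, hu1, Hu⟩ := Ha.add_Ioo (sm Hω) (A := -θ / 2) (B := Real.pi - θ)
      (by linarith) (by linarith) (by linarith) (by linarith) (by linarith)
    exact (Hu.div (sm Hz)).concl (by linarith) (by linarith) (by linarith) (by linarith)
end

section
/- Let 0 < θ < π/2, ε > 0, and let α, R, κ > 0 be real parameters. There exists a constant c > 0 such that for all λ ∈ Σ_{π−θ} and all z ∈ Σ_{θ/2}, setting λ_ε := ε + λ and ω := √(λ_ε + z²), one has |1 + Rκ(ω + z)/(α√R·λ_ε)| ≥ c, |1 + (α√R·λ_ε + Rκz)/(Rκω)| ≥ c, and |1 + (α√R·λ_ε + Rκω)/(Rκz)| ≥ c; i.e. the reciprocals m₁⁻¹, m₂⁻¹, m₃⁻¹ of the symbol factors m₁, m₂, m₃ stay uniformly away from the origin on Σ_{π−θ} × Σ_{θ/2}. -/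
open Complex in
/-- Points of a narrow cone have a large component along its axis. -/
lemma cone_aux (β φ t r : ℝ) (hr : 0 ≤ r) (hφ : φ ≤ Real.pi) (h : |t - β| ≤ φ) :
    Real.cos φ * ‖(r : ℂ) * exp (t * I)‖ ≤ (exp (-(β : ℂ) * I) * ((r : ℂ) * exp (t * I))).re := by
  have h1 : exp (-(β : ℂ) * I) * ((r : ℂ) * exp (t * I)) = (r : ℂ) * exp (((t - β : ℝ) : ℂ) * I) := by
    rw [mul_left_comm, ← Complex.exp_add]; congr 2; push_cast; ring
  rw [h1, norm_mul, norm_exp_ofReal_mul_I, mul_one, re_ofReal_mul, exp_ofReal_mul_I_re,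
    Complex.norm_real, Real.norm_of_nonneg hr, mul_comm]
  apply mul_le_mul_of_nonneg_left _ hr
  rw [← Real.cos_abs (t - β)]
  exact Real.cos_le_cos_of_nonneg_of_le_pi (abs_nonneg _) hφ h

open Complex in
lemma cone_arg (β φ : ℝ) (w : ℂ) (hφ : φ ≤ Real.pi) (h : |w.arg - β| ≤ φ) :
    Real.cos φ * ‖w‖ ≤ (exp (-(β : ℂ) * I) * w).re := by
  have := cone_aux β φ w.arg ‖w‖ (norm_nonneg _) hφ h
  rwa [norm_mul_exp_arg_mul_I] at this

open Complex in
lemma im_rot (θ : ℝ) (w : ℂ) : (exp ((θ : ℂ) * I) * w).im = ‖w‖ * Real.sin (w.arg + θ) := by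
  conv_lhs => rw [← norm_mul_exp_arg_mul_I w]
  have h1 : exp ((θ : ℂ) * I) * ((‖w‖ : ℂ) * exp (w.arg * I))
      = (‖w‖ : ℂ) * exp (((w.arg + θ : ℝ) : ℂ) * I) := by
    rw [mul_left_comm, ← Complex.exp_add]; congr 2; push_cast; ring
  rw [h1, im_ofReal_mul, exp_ofReal_mul_I_im]

open Complex in
lemma core_aux (θ ε A B : ℝ) (hθ₀ : 0 < θ) (hθ₁ : θ < Real.pi / 2) (hε : 0 < ε)
    (hA : 0 < A) (hB : 0 < B) (l z : ℂ) (hl : l ∈ sector (Real.pi - θ))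
    (hz : z ∈ sector (θ / 2)) (him : 0 ≤ l.im) :
    (ε : ℂ) + l ≠ 0 ∧ ((ε : ℂ) + l) + z ^ 2 ≠ 0 ∧ (((ε : ℂ) + l) + z ^ 2).arg ≠ Real.pi ∧
    Real.sin (θ / 4) * (‖(A : ℂ) * (ε + l)‖ + ‖(B : ℂ) * (((ε : ℂ) + l) + z ^ 2) ^ (1/2 : ℂ)‖
        + ‖(B : ℂ) * z‖) ≤
      ‖(A : ℂ) * (ε + l) + (B : ℂ) * (((ε : ℂ) + l) + z ^ 2) ^ (1/2 : ℂ) + (B : ℂ) * z‖ := by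
  have hpi := Real.pi_pos
  obtain ⟨hl0, hl⟩ := hl
  obtain ⟨hz0, hz⟩ := hz
  rw [abs_lt] at hl hz
  have hla : 0 ≤ l.arg := arg_nonneg_iff.2 him
  have sl : 0 < (exp ((θ : ℂ) * I) * l).im := by
    rw [im_rot]
    exact mul_pos (norm_pos_iff.2 hl0) (Real.sin_pos_of_pos_of_lt_pi (by linarith) (by linarith))
  have sε : 0 < (exp ((θ : ℂ) * I) * (ε : ℂ)).im := by
    rw [im_rot, arg_ofReal_of_nonneg hε.le]
    exact mul_pos (norm_pos_iff.2 (by exact_mod_cast hε.ne'))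
      (Real.sin_pos_of_pos_of_lt_pi (by linarith) (by linarith))
  have sz : 0 < (exp ((θ : ℂ) * I) * z ^ 2).im := by
    have e : exp ((θ : ℂ) * I) * z ^ 2 = ((‖z‖ ^ 2 : ℝ) : ℂ) * exp (((2 * z.arg + θ : ℝ) : ℂ) * I) := by
      conv_lhs => rw [← norm_mul_exp_arg_mul_I z]
      rw [mul_pow, ← Complex.exp_nat_mul, mul_left_comm, ← Complex.exp_add]
      push_cast; congr 2; ring
    rw [e, im_ofReal_mul, exp_ofReal_mul_I_im]
    exact mul_pos (pow_pos (norm_pos_iff.2 hz0) 2)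
      (Real.sin_pos_of_pos_of_lt_pi (by linarith) (by linarith))
  have hle0 : (ε : ℂ) + l ≠ 0 := by
    intro h
    have : 0 < (exp ((θ : ℂ) * I) * ((ε : ℂ) + l)).im := by
      rw [mul_add, add_im]; linarith
    simp [h] at this
  have sW : 0 < (exp ((θ : ℂ) * I) * (((ε : ℂ) + l) + z ^ 2)).im := by
    rw [mul_add, mul_add, add_im, add_im]; linarith
  set W : ℂ := ((ε : ℂ) + l) + z ^ 2 with hW
  have hW0 : W ≠ 0 := by
    intro h; simp [h] at sW
  rw [im_rot] at sW
  have sW' : 0 < Real.sin (W.arg + θ) := pos_of_mul_pos_right sW (norm_nonneg _)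
  have hWl : 0 < W.arg + θ := by
    by_contra! h
    have := Real.sin_nonpos_of_nonpos_of_neg_pi_le h (by linarith [neg_pi_lt_arg W])
    linarith
  have hWu : W.arg + θ < Real.pi := by
    by_contra! h
    have := Real.sin_nonneg_of_nonneg_of_le_pi (x := W.arg + θ - Real.pi) (by linarith)
      (by linarith [arg_le_pi W])
    rw [Real.sin_sub_pi] at this
    linarith
  refine ⟨hle0, hW0, by linarith, ?_⟩
  have hω : W ^ (1/2 : ℂ) = ((Real.exp (Real.log ‖W‖ / 2) : ℝ) : ℂ) * exp (((W.arg / 2 : ℝ) : ℂ) * I) := by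
    rw [cpow_def_of_ne_zero hW0, Complex.log, ofReal_exp, ← Complex.exp_add]
    congr 1; push_cast; ring
  set β : ℝ := Real.pi / 2 - 3 * θ / 4 with hβ
  set φ : ℝ := Real.pi / 2 - θ / 4 with hφ
  have hcos : Real.sin (θ / 4) = Real.cos φ := by rw [hφ, Real.cos_pi_div_two_sub]
  have hφp : φ ≤ Real.pi := by rw [hφ]; linarith
  have Cε := cone_arg β φ ε hφp (by
    rw [arg_ofReal_of_nonneg hε.le, abs_le, hβ, hφ]; constructor <;> linarith)
  have Cl := cone_arg β φ l hφp (by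
    rw [abs_le, hβ, hφ]; constructor <;> linarith)
  have Cz := cone_arg β φ z hφp (by
    rw [abs_le, hβ, hφ]; constructor <;> linarith)
  have Cω := cone_aux β φ (W.arg / 2) (Real.exp (Real.log ‖W‖ / 2)) (Real.exp_pos _).le hφp (by
    rw [abs_le, hβ, hφ]; constructor <;> linarith)
  rw [← hω] at Cω
  have hs : 0 ≤ Real.cos φ := by
    rw [← hcos]; exact Real.sin_nonneg_of_nonneg_of_le_pi (by linarith) (by linarith)
  have Cle : Real.cos φ * ‖(ε : ℂ) + l‖ ≤ (exp (-(β : ℂ) * I) * ((ε : ℂ) + l)).re := by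
    have := mul_le_mul_of_nonneg_left (norm_add_le (ε : ℂ) l) hs
    rw [mul_add (exp _), add_re]; linarith
  have hfin := Complex.re_le_norm (exp (-(β : ℂ) * I) *
    ((A : ℂ) * (ε + l) + (B : ℂ) * W ^ (1/2 : ℂ) + (B : ℂ) * z))
  have hn : ‖exp (-(β : ℂ) * I)‖ = 1 := by
    have := norm_exp_ofReal_mul_I (-β)
    rwa [ofReal_neg] at this
  rw [norm_mul, hn, one_mul] at hfin
  refine le_trans ?_ hfin
  rw [mul_add (exp _), mul_add (exp _), add_re, add_re, mul_left_comm _ (A : ℂ),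
    mul_left_comm _ (B : ℂ), mul_left_comm _ (B : ℂ), re_ofReal_mul, re_ofReal_mul,
    re_ofReal_mul, norm_mul, norm_mul, norm_mul, Complex.norm_real, Complex.norm_real,
    Real.norm_of_nonneg hA.le, Real.norm_of_nonneg hB.le, hcos]
  have := mul_le_mul_of_nonneg_left Cle hA.le
  have := mul_le_mul_of_nonneg_left Cω hB.le
  have := mul_le_mul_of_nonneg_left Cz hB.le
  linarith

open Complex in
lemma conj_sector {ψ : ℝ} {w : ℂ} (hψ : ψ ≤ Real.pi) (hw : w ∈ sector ψ) :
    (starRingEnd ℂ) w ∈ sector ψ := by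
  obtain ⟨h0, h⟩ := hw
  refine ⟨by simpa using h0, ?_⟩
  have : w.arg ≠ Real.pi := by
    have := (abs_lt.1 h).2
    linarith
  rw [arg_conj, if_neg this, abs_neg]
  exact h

open Complex in
lemma core_full (θ ε A B : ℝ) (hθ₀ : 0 < θ) (hθ₁ : θ < Real.pi / 2) (hε : 0 < ε)
    (hA : 0 < A) (hB : 0 < B) (l z : ℂ) (hl : l ∈ sector (Real.pi - θ))
    (hz : z ∈ sector (θ / 2)) :
    (ε : ℂ) + l ≠ 0 ∧ ((ε : ℂ) + l) + z ^ 2 ≠ 0 ∧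
    Real.sin (θ / 4) * (‖(A : ℂ) * (ε + l)‖ + ‖(B : ℂ) * (((ε : ℂ) + l) + z ^ 2) ^ (1/2 : ℂ)‖
        + ‖(B : ℂ) * z‖) ≤
      ‖(A : ℂ) * (ε + l) + (B : ℂ) * (((ε : ℂ) + l) + z ^ 2) ^ (1/2 : ℂ) + (B : ℂ) * z‖ := by
  rcases le_total 0 l.im with h | h
  · obtain ⟨h1, h2, -, h3⟩ := core_aux θ ε A B hθ₀ hθ₁ hε hA hB l z hl hz h
    exact ⟨h1, h2, h3⟩
  · obtain ⟨h1, h2, h4, h3⟩ := core_aux θ ε A B hθ₀ hθ₁ hε hA hB _ _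
      (conj_sector (by linarith) hl) (conj_sector (by linarith [Real.pi_pos]) hz)
      (by rw [conj_im]; linarith)
    have e1 : (ε : ℂ) + (starRingEnd ℂ) l = (starRingEnd ℂ) ((ε : ℂ) + l) := by simp
    have e2 : (ε : ℂ) + (starRingEnd ℂ) l + (starRingEnd ℂ) z ^ 2
        = (starRingEnd ℂ) ((ε : ℂ) + l + z ^ 2) := by simp
    have e3 : (((ε : ℂ) + l) + z ^ 2) ^ (1/2 : ℂ) = (starRingEnd ℂ)
        (((ε : ℂ) + (starRingEnd ℂ) l + (starRingEnd ℂ) z ^ 2) ^ (1/2 : ℂ)) := by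
      have := conj_cpow _ (1/2 : ℂ) h4
      rw [e2, Complex.conj_conj] at this
      rw [this, e2]
      congr 2
      rw [map_div₀, map_one, Complex.conj_ofNat]
    have e4 := congrArg (starRingEnd ℂ) e3
    rw [Complex.conj_conj] at e4
    rw [← e4, e1] at h3
    refine ⟨?_, ?_, ?_⟩
    · rw [e1] at h1
      exact fun h => h1 (by rw [h, map_zero])
    · rw [e2] at h2
      exact fun h => h2 (by rw [h, map_zero])
    · have c : ∀ r : ℝ, (r : ℂ) = (starRingEnd ℂ) r := fun r => (conj_ofReal r).symm
      rw [c A, c B] at h3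
      simp only [← map_mul, ← map_add] at h3
      simpa only [RCLike.norm_conj] using h3

/-- The reciprocals `m₁⁻¹, m₂⁻¹, m₃⁻¹` of the symbol factors stay uniformly away from the
origin on `Σ_{π-θ} × Σ_{θ/2}`. -/
theorem symbol_reciprocals_bounded_below (θ ε α R κ : ℝ)
    (hθ₀ : 0 < θ) (hθ₁ : θ < Real.pi / 2) (hε : 0 < ε)
    (hα : 0 < α) (hR : 0 < R) (hκ : 0 < κ) :
    ∃ c > 0, ∀ l ∈ sector (Real.pi - θ), ∀ z ∈ sector (θ / 2),
      let lε : ℂ := (ε : ℂ) + l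
      let ω : ℂ := (lε + z ^ 2) ^ (1/2 : ℂ)
      let a : ℂ := (α : ℂ) * (Real.sqrt R : ℂ) * lε
      c ≤ ‖1 + (R : ℂ) * (κ : ℂ) * (ω + z) / a‖ ∧
      c ≤ ‖1 + (a + (R : ℂ) * (κ : ℂ) * z) / ((R : ℂ) * (κ : ℂ) * ω)‖ ∧
      c ≤ ‖1 + (a + (R : ℂ) * (κ : ℂ) * ω) / ((R : ℂ) * (κ : ℂ) * z)‖ := by
  refine ⟨Real.sin (θ / 4), Real.sin_pos_of_pos_of_lt_pi (by linarith) (by linarith), ?_⟩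
  intro l hl z hz
  have hs : 0 < Real.sin (θ / 4) := Real.sin_pos_of_pos_of_lt_pi (by linarith) (by linarith)
  have hA : 0 < α * Real.sqrt R := mul_pos hα (Real.sqrt_pos.2 hR)
  have hB : 0 < R * κ := mul_pos hR hκ
  obtain ⟨h1, h2, h3⟩ := core_full θ ε _ _ hθ₀ hθ₁ hε hA hB l z hl hz
  have hz0 : z ≠ 0 := hz.1
  intro lε ω a
  have hω0 : ω ≠ 0 := by
    simp only [ω, lε]
    rw [Complex.cpow_def_of_ne_zero h2]
    exact Complex.exp_ne_zero _
  have hB0 : (R : ℂ) * (κ : ℂ) ≠ 0 := by exact_mod_cast hB.ne'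
  have hA0 : (α : ℂ) * (Real.sqrt R : ℂ) ≠ 0 := by exact_mod_cast hA.ne'
  have ha0 : a ≠ 0 := mul_ne_zero hA0 h1
  push_cast at h3
  change Real.sin (θ / 4) * (‖a‖ + ‖(R : ℂ) * (κ : ℂ) * ω‖ + ‖(R : ℂ) * (κ : ℂ) * z‖)
    ≤ ‖a + (R : ℂ) * (κ : ℂ) * ω + (R : ℂ) * (κ : ℂ) * z‖ at h3
  have key : ∀ x y : ℂ, x ≠ 0 → x + y = a + (R : ℂ) * (κ : ℂ) * ω + (R : ℂ) * (κ : ℂ) * z →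
      ‖x‖ ≤ ‖a‖ + ‖(R : ℂ) * (κ : ℂ) * ω‖ + ‖(R : ℂ) * (κ : ℂ) * z‖ →
      Real.sin (θ / 4) ≤ ‖1 + y / x‖ := by
    intro x y hx hxy hn
    have : 1 + y / x = (x + y) / x := by field_simp
    rw [this, norm_div, le_div_iff₀ (norm_pos_iff.2 hx), hxy]
    exact (mul_le_mul_of_nonneg_left hn hs.le).trans h3
  have n1 := norm_nonneg a
  have n2 := norm_nonneg ((R : ℂ) * (κ : ℂ) * ω)
  have n3 := norm_nonneg ((R : ℂ) * (κ : ℂ) * z)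
  refine ⟨key _ _ ha0 (by ring) (by linarith), key _ _ (mul_ne_zero hB0 hω0) (by ring) (by linarith),
    key _ _ (mul_ne_zero hB0 hz0) (by ring) (by linarith)⟩
end

section
/- Let n ≥ 2 and let α, R, κ > 0 be real parameters. Let ζ ∈ ℝ^{n−1} with z := ‖ζ‖, let λ_ε, ω ∈ ℂ satisfy ω² = λ_ε + z², and set φ := α√R·λ_ε·ω + Rκω² and β := α√R·λ_ε + Rκz + z. Assume φ ≠ 0 and φ + z² ≠ 0. If τ_v ∈ ℂ^{n−1} and τ_w, h ∈ ℂ satisfy the boundary system (φ·I + ζζᵀ)τ_v = β·τ_w·(iζ) and i·⟪ζ, τ_v⟫ + z·τ_w = h, then (α√R·λ_ε + Rκ(ω + z)) · λ_ε · z · τ_w = (φ + z²) · (ω + z) · h. (Equivalently, the transformed normal pressure derivative λ_ε z τ_w equals (φ+z²)(ω+z)/(α√R λ_ε + Rκ(ω+z)) times h whenever the latter denominator is nonzero.) -/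
/-- Solution of the Laplace–Fourier transformed boundary conditions for the Stokes
equations in the halfspace with the tangentially dynamic outflow condition (TDO):
the transformed normal pressure derivative `λ_ε z τ_w` satisfies
`(α√R λ_ε + Rκ(ω+z))·λ_ε·z·τ_w = (φ+z²)(ω+z)·h`. -/
theorem tdo_boundary_symbol_solution (n : ℕ) (hn : 2 ≤ n) (α R κ : ℝ)
    (hα : 0 < α) (hR : 0 < R) (hκ : 0 < κ)
    (ζ : EuclideanSpace ℝ (Fin (n - 1))) (lε ω : ℂ)
    (τv : Fin (n - 1) → ℂ) (τw h : ℂ) :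
    let z : ℂ := (‖ζ‖ : ℂ)
    let ζc : Fin (n - 1) → ℂ := fun j => (ζ j : ℂ)
    let a : ℂ := (α : ℂ) * (Real.sqrt R : ℂ) * lε
    let φ : ℂ := a * ω + (R : ℂ) * (κ : ℂ) * ω ^ 2
    let β : ℂ := a + (R : ℂ) * (κ : ℂ) * z + z
    ω ^ 2 = lε + z ^ 2 →
    φ ≠ 0 → φ + z ^ 2 ≠ 0 →
    (φ • (1 : Matrix (Fin (n - 1)) (Fin (n - 1)) ℂ)
        + Matrix.vecMulVec ζc ζc).mulVec τv
      = (fun j => β * τw * (Complex.I * ζc j)) →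
    Complex.I * (∑ j, ζc j * τv j) + z * τw = h →
    (a + (R : ℂ) * (κ : ℂ) * (ω + z)) * lε * z * τw = (φ + z ^ 2) * (ω + z) * h := by
  intro z ζc a φ β hω _ _ hsys hh
  have hz : ∑ j, ζc j * ζc j = z ^ 2 := by
    have h1 := EuclideanSpace.real_norm_sq_eq ζ
    simp only [z, ζc]
    rw [← Complex.ofReal_pow, h1]
    push_cast
    exact Finset.sum_congr rfl fun j _ => by ring
  have hj : ∀ j, φ * τv j + ζc j * (∑ k, ζc k * τv k) = β * τw * (Complex.I * ζc j) := by
    intro j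
    have h1 := congrFun hsys j
    rw [Matrix.add_mulVec, Matrix.smul_mulVec, Matrix.one_mulVec, Matrix.vecMulVec_mulVec] at h1
    simpa [dotProduct, mul_comm] using h1
  generalize hS : ∑ k, ζc k * τv k = S at hj hh
  have hS2 : (φ + z ^ 2) * S = Complex.I * β * τw * z ^ 2 := by
    have h2 : ∑ j, ζc j * (φ * τv j + ζc j * S)
        = ∑ j, ζc j * (β * τw * (Complex.I * ζc j)) :=
      Finset.sum_congr rfl fun j _ => by rw [hj j]
    have e1 : ∑ j, ζc j * (φ * τv j + ζc j * S)
        = φ * (∑ j, ζc j * τv j) + (∑ j, ζc j * ζc j) * S := by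
      rw [Finset.mul_sum, Finset.sum_mul, ← Finset.sum_add_distrib]
      exact Finset.sum_congr rfl fun j _ => by ring
    have e2 : ∑ j, ζc j * (β * τw * (Complex.I * ζc j))
        = Complex.I * β * τw * (∑ j, ζc j * ζc j) := by
      rw [Finset.mul_sum]
      exact Finset.sum_congr rfl fun j _ => by ring
    rw [e1, e2, hS, hz] at h2
    linear_combination h2
  have hφ : φ = a * ω + (R : ℂ) * (κ : ℂ) * ω ^ 2 := rfl
  have hβ : β = a + (R : ℂ) * (κ : ℂ) * z + z := rfl
  clear_value φ β a z
  have key : (φ + z ^ 2) * h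
      = z * τw * (ω - z) * (a + (R : ℂ) * (κ : ℂ) * (ω + z)) := by
    have : (φ + z ^ 2) * h = z * τw * (φ + z ^ 2 - β * z) := by
      linear_combination (-(φ + z ^ 2)) * hh + Complex.I * hS2 + β * τw * z ^ 2 * Complex.I_sq
    rw [this, hφ, hβ]
    ring
  linear_combination (-(ω + z)) * key - (a + (R : ℂ) * (κ : ℂ) * (ω + z)) * z * τw * hω
end

section
/- Let 0 < θ < π/2, ε > 0, and let α, R > 0 be real parameters. For λ ∈ Σ_{π−θ} and z ∈ Σ_{θ/2} set λ_ε := ε + λ and ω(λ,z) := √(λ_ε + z²). Then: (i) there is a constant c > 0 such that |1 + √R·α·z·(1 − z/ω(λ,z))| ≥ c for all (λ,z) ∈ Σ_{π−θ} × Σ_{θ/2}; (ii) the functions Π̂(λ,z) := ( 1 + √R·α·z·(1 − z/ω) )⁻¹ and Σ̂(λ,z) := √R·α·z·(1 − z/ω) · Π̂(λ,z) are bounded and holomorphic on the open set Σ_{π−θ} × Σ_{θ/2} ⊆ ℂ × ℂ; and (iii) the function (λ,z) ↦ Σ̂(λ,z)·(1 + z)/z is also bounded and holomorphic there. -/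
lemma exp_add_aux (x y : ℂ) (h1 : y.im ≤ x.im) (h2 : x.im - y.im < Real.pi) :
    ∃ c : ℂ, Complex.exp x + Complex.exp y = Complex.exp c ∧ y.im ≤ c.im ∧ c.im ≤ x.im := by
  set h : ℂ := (x - y) / 2 with hh
  set D : ℂ := Complex.exp h + Complex.exp (-h) with hD
  have hk : h.im = (x.im - y.im) / 2 := by simp [hh]
  have hcos : 0 < Real.cos h.im := Real.cos_pos_of_mem_Ioo ⟨by linarith [Real.pi_pos], by linarith⟩
  have hre : 0 < D.re := by
    simp only [hD, Complex.add_re, Complex.exp_re, Complex.neg_re, Complex.neg_im, Real.cos_neg]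
    positivity
  have hD0 : D ≠ 0 := by
    intro h0
    rw [h0] at hre
    simp at hre
  have hd : |(Complex.log D).im| < Real.pi / 2 := by
    rw [Complex.log_im, Complex.abs_arg_lt_pi_div_two_iff]
    exact Or.inl hre
  rw [abs_lt] at hd
  have hsin : 0 ≤ Real.sin (2 * h.im) := Real.sin_nonneg_of_nonneg_of_le_pi (by linarith) (by linarith)
  have hE : Complex.exp (Complex.log D) = D := Complex.exp_log hD0
  have e1 : Complex.exp (Complex.log D - h) = 1 + Complex.exp (-(2 * h)) := by
    rw [sub_eq_add_neg, Complex.exp_add, hE, hD, add_mul, ← Complex.exp_add, ← Complex.exp_add]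
    congr 1
    · simp
    · congr 1; ring
  have e2 : Complex.exp (Complex.log D + h) = Complex.exp (2 * h) + 1 := by
    rw [Complex.exp_add, hE, hD, add_mul, ← Complex.exp_add, ← Complex.exp_add]
    congr 1
    · congr 1; ring
    · simp
  have i1 := congrArg Complex.im e1
  have i2 := congrArg Complex.im e2
  have m2 : (2 * h).im = 2 * h.im := by simp
  simp only [Complex.add_im, Complex.exp_im, Complex.sub_im, Complex.neg_im, Complex.one_im, m2,
    Real.sin_neg] at i1 i2
  refine ⟨(x + y) / 2 + Complex.log D, ?_, ?_, ?_⟩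
  · rw [Complex.exp_add, hE, hD, mul_add, ← Complex.exp_add, ← Complex.exp_add]
    congr 2 <;> rw [hh] <;> ring
  · have : (((x + y) / 2 + Complex.log D).im) = (x.im + y.im) / 2 + (Complex.log D).im := by simp
    rw [this]
    by_contra! hc
    have : Real.sin ((Complex.log D).im + h.im) < 0 :=
      Real.sin_neg_of_neg_of_neg_pi_lt (by linarith) (by linarith)
    have p1 := mul_neg_of_pos_of_neg (Real.exp_pos (Complex.log D + h).re) this
    have p2 := mul_nonneg (Real.exp_pos (2 * h).re).le hsin
    linarith
  · have : (((x + y) / 2 + Complex.log D).im) = (x.im + y.im) / 2 + (Complex.log D).im := by simp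
    rw [this]
    by_contra! hc
    have : 0 < Real.sin ((Complex.log D).im - h.im) :=
      Real.sin_pos_of_pos_of_lt_pi (by linarith) (by linarith)
    have p1 := mul_pos (Real.exp_pos (Complex.log D - h).re) this
    have p2 := mul_nonneg (Real.exp_pos (-(2 * h)).re).le hsin
    linarith

/-- A sum of two exponentials whose imaginary parts differ by less than `π`. -/
lemma exp_add_polar (x y : ℂ) (h : |x.im - y.im| < Real.pi) :
    ∃ c : ℂ, Complex.exp x + Complex.exp y = Complex.exp c ∧
      min x.im y.im ≤ c.im ∧ c.im ≤ max x.im y.im := by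
  rw [abs_lt] at h
  rcases le_total y.im x.im with h1 | h1
  · obtain ⟨c, e, a, b⟩ := exp_add_aux x y h1 (by linarith)
    exact ⟨c, e, by simp [h1, a], by simp [h1, b]⟩
  · obtain ⟨c, e, a, b⟩ := exp_add_aux y x h1 (by linarith)
    exact ⟨c, by rw [add_comm, e], by simp [h1, a], by simp [h1, b]⟩

lemma norm_one_add_exp (x : ℂ) (δ : ℝ) (h0 : 0 < δ) (hx : |x.im| ≤ Real.pi - δ) :
    Real.sin δ ≤ ‖1 + Complex.exp x‖ := by
  have hc : -Real.cos δ ≤ Real.cos x.im := by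
    rw [← Real.cos_abs x.im, ← Real.cos_pi_sub]
    exact Real.cos_le_cos_of_nonneg_of_le_pi (abs_nonneg _) (by linarith) hx
  rw [Complex.norm_def]
  apply Real.le_sqrt_of_sq_le
  rw [Complex.normSq_apply]
  simp only [Complex.add_re, Complex.add_im, Complex.exp_re, Complex.exp_im, Complex.one_re,
    Complex.one_im]
  have hp := Real.exp_pos x.re
  have e : (1 + Real.exp x.re * Real.cos x.im) * (1 + Real.exp x.re * Real.cos x.im) +
      (0 + Real.exp x.re * Real.sin x.im) * (0 + Real.exp x.re * Real.sin x.im) =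
      1 + 2 * (Real.exp x.re * Real.cos x.im) + Real.exp x.re ^ 2 := by
    linear_combination Real.exp x.re ^ 2 * Real.sin_sq_add_cos_sq x.im
  rw [e]
  nlinarith [Real.sin_sq_add_cos_sq δ,
    mul_le_mul_of_nonneg_left hc hp.le, sq_nonneg (Real.exp x.re - Real.cos δ)]

/-- Key facts about the symbol at a single point. -/
lemma key (θ ε a : ℝ) (hθ₀ : 0 < θ) (hθ₁ : θ < Real.pi / 2) (hε : 0 < ε) (ha : 0 < a)
    (l z : ℂ) (hl : l ∈ sector (Real.pi - θ)) (hz : z ∈ sector (θ / 2)) :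
    (ε : ℂ) + l + z ^ 2 ∈ Complex.slitPlane ∧
    Real.sin (θ / 2) ≤ ‖1 + (a : ℂ) * z * (1 - z / ((ε : ℂ) + l + z ^ 2) ^ (1 / 2 : ℂ))‖ ∧
    ε * Real.sin θ ≤ ‖(ε : ℂ) + l‖ := by
  obtain ⟨hl0, hl1⟩ := hl
  obtain ⟨hz0, hz1⟩ := hz
  have eε : Complex.exp (Real.log ε : ℂ) = ε := by
    rw [← Complex.ofReal_exp, Real.exp_log hε]
  have ea : Complex.exp (Real.log a : ℂ) = a := by
    rw [← Complex.ofReal_exp, Real.exp_log ha]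
  have el := Complex.exp_log hl0
  have ez := Complex.exp_log hz0
  rw [← Complex.log_im] at hl1 hz1
  set Z := Complex.log z
  set L := Complex.log l
  have h3 : ε * Real.sin θ ≤ ‖(ε : ℂ) + l‖ := by
    have := norm_one_add_exp (L - Real.log ε) θ hθ₀ (by simpa using hl1.le)
    rw [Complex.exp_sub, eε, el] at this
    have e : (ε : ℂ) + l = ε * (1 + l / ε) := by
      have : (ε : ℂ) ≠ 0 := by exact_mod_cast hε.ne'
      field_simp
    rw [e, norm_mul, Complex.norm_real, Real.norm_of_nonneg hε.le]
    exact mul_le_mul_of_nonneg_left this hε.le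
  obtain ⟨M, eM, M1, M2⟩ := exp_add_polar (Real.log ε : ℂ) L (by
    simp only [Complex.ofReal_im, zero_sub, abs_neg]; linarith)
  rw [eε, el] at eM
  rw [abs_lt] at hl1 hz1
  have M3 : |M.im| < Real.pi - θ := by
    simp only [Complex.ofReal_im] at M1 M2
    rw [abs_lt]
    constructor
    · exact lt_of_lt_of_le (lt_min (by linarith) hl1.1) M1
    · exact lt_of_le_of_lt M2 (max_lt (by linarith) hl1.2)
  rw [abs_lt] at M3
  have z2 : (2 * Z).im = 2 * Z.im := by simp
  obtain ⟨W, eW, W1, W2⟩ := exp_add_polar M (2 * Z) (by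
    rw [z2, abs_lt]; constructor <;> linarith)
  have ez2 : Complex.exp (2 * Z) = z ^ 2 := by
    rw [two_mul, Complex.exp_add, ez, sq]
  rw [← eM, ez2] at eW
  rw [z2] at W1 W2
  have W3 : -Real.pi < W.im := lt_of_lt_of_le (lt_min (by linarith) (by linarith)) W1
  have W4 : W.im < Real.pi := lt_of_le_of_lt W2 (max_lt (by linarith) (by linarith))
  have hlog := Complex.log_exp W3 W4.le
  have eω : ((ε : ℂ) + l + z ^ 2) ^ (1 / 2 : ℂ) = Complex.exp (W / 2) := by
    rw [eW, Complex.cpow_def_of_ne_zero (Complex.exp_ne_zero _), hlog]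
    congr 1; ring
  have w2 : (W / 2).im = W.im / 2 := by simp
  have B : |Z.im + M.im - W.im| < Real.pi := by
    rcases le_total M.im (2 * Z.im) with h | h <;> simp only [h, min_eq_left, min_eq_right, max_eq_left, max_eq_right] at W1 W2 <;>
      rw [abs_lt] <;> constructor <;> linarith
  obtain ⟨Q, eQ, Q1, Q2⟩ := exp_add_polar (W / 2) Z (by
    rw [w2]
    rcases le_total M.im (2 * Z.im) with h | h <;> simp only [h, min_eq_left, min_eq_right, max_eq_left, max_eq_right] at W1 W2 <;>
      rw [abs_lt] <;> constructor <;> linarith)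
  rw [ez] at eQ
  rw [w2] at Q1 Q2
  refine ⟨?_, ?_, h3⟩
  · rw [Complex.mem_slitPlane_iff_arg, eW]
    refine ⟨?_, Complex.exp_ne_zero _⟩
    rw [← Complex.log_im, hlog]
    exact W4.ne
  · rw [eω]
    have eg : (a : ℂ) * z * (1 - z / Complex.exp (W / 2)) =
        Complex.exp (Real.log a + Z + M - W / 2 - Q) := by
      rw [Complex.exp_sub, Complex.exp_sub, Complex.exp_add, Complex.exp_add, ea, ez, ← eM, ← eQ]
      have n1 := Complex.exp_ne_zero (W / 2)
      have n2 : Complex.exp (W / 2) + z ≠ 0 := by rw [eQ]; exact Complex.exp_ne_zero _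
      have sq : Complex.exp (W / 2) ^ 2 = ε + l + z ^ 2 := by
        rw [eW, ← Complex.exp_nat_mul]; congr 1; push_cast; ring
      field_simp
      linear_combination (a : ℂ) * sq
    rw [eg]
    apply norm_one_add_exp _ _ (by linarith)
    have : (Real.log a + Z + M - W / 2 - Q).im = Z.im + M.im - W.im / 2 - Q.im := by simp
    rw [this]
    rcases le_total M.im (2 * Z.im) with h | h <;> simp only [h, min_eq_left, min_eq_right, max_eq_left, max_eq_right] at W1 W2 <;>
    rcases le_total (W.im / 2) Z.im with h' | h' <;> simp only [h', min_eq_left, min_eq_right, max_eq_left, max_eq_right] at Q1 Q2 <;>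
      rw [abs_le] <;> constructor <;> linarith

/-- The symbols `Π̂` and `Σ̂` of the operators `Π` and `Σ` for the normally dynamic outflow
condition: (i) `1 + √R·α·z·(1 - z/ω)` is uniformly bounded away from 0; (ii) `Π̂` and `Σ̂`
are bounded and holomorphic on `Σ_{π-θ} × Σ_{θ/2}`; (iii) `Σ̂·(1+z)/z` is also bounded
and holomorphic there. -/
theorem ndo_symbols_bounded_holomorphic (θ ε α R : ℝ)
    (hθ₀ : 0 < θ) (hθ₁ : θ < Real.pi / 2) (hε : 0 < ε) (hα : 0 < α) (hR : 0 < R) :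
    let S : Set (ℂ × ℂ) := {p | p.1 ∈ sector (Real.pi - θ) ∧ p.2 ∈ sector (θ / 2)}
    let ω : ℂ × ℂ → ℂ := fun p => ((ε : ℂ) + p.1 + p.2 ^ 2) ^ (1/2 : ℂ)
    let g : ℂ × ℂ → ℂ := fun p => (Real.sqrt R : ℂ) * (α : ℂ) * p.2 * (1 - p.2 / ω p)
    let Pihat : ℂ × ℂ → ℂ := fun p => (1 + g p)⁻¹
    let Sighat : ℂ × ℂ → ℂ := fun p => g p * Pihat p
    (∃ c > 0, ∀ p ∈ S, c ≤ ‖1 + g p‖) ∧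
    ((∃ C, ∀ p ∈ S, ‖Pihat p‖ ≤ C ∧ ‖Sighat p‖ ≤ C) ∧
      DifferentiableOn ℂ Pihat S ∧ DifferentiableOn ℂ Sighat S) ∧
    ((∃ C, ∀ p ∈ S, ‖Sighat p * (1 + p.2) / p.2‖ ≤ C) ∧
      DifferentiableOn ℂ (fun p => Sighat p * (1 + p.2) / p.2) S) := by
  intro S ω g Pihat Sighat
  have ha : 0 < Real.sqrt R * α := mul_pos (Real.sqrt_pos.2 hR) hα
  set a := Real.sqrt R * α with hadef
  have hg : ∀ p, g p = (a : ℂ) * p.2 * (1 - p.2 / ω p) := by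
    intro p; simp [g, hadef]
  have K : ∀ p ∈ S, _ := fun p hp => key θ ε a hθ₀ hθ₁ hε ha p.1 p.2 hp.1 hp.2
  set s := Real.sin (θ / 2) with hs
  have hs0 : 0 < s := Real.sin_pos_of_pos_of_lt_pi (by linarith) (by linarith)
  have hsθ : 0 < Real.sin θ := Real.sin_pos_of_pos_of_lt_pi (by linarith) (by linarith)
  have A1 : ∀ p ∈ S, s ≤ ‖1 + g p‖ := by
    intro p hp
    rw [hg]; exact (K p hp).2.1
  have N1 : ∀ p ∈ S, 1 + g p ≠ 0 := by
    intro p hp h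
    have := A1 p hp
    rw [h, norm_zero] at this
    linarith
  have A2 : ∀ p ∈ S, ‖Pihat p‖ ≤ s⁻¹ := by
    intro p hp
    simp only [Pihat, norm_inv]
    exact inv_anti₀ hs0 (A1 p hp)
  have A3 : ∀ p ∈ S, ‖Sighat p‖ ≤ 1 + s⁻¹ := by
    intro p hp
    have : Sighat p = 1 - Pihat p := by
      simp only [Sighat, Pihat]
      have := N1 p hp
      field_simp
      ring
    rw [this]
    refine (norm_sub_le _ _).trans ?_
    rw [norm_one]
    linarith [A2 p hp]
  have Dω : ∀ p ∈ S, DifferentiableAt ℂ ω p := by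
    intro p hp
    exact DifferentiableAt.cpow_const (by fun_prop) (K p hp).1
  have ω0 : ∀ p ∈ S, ω p ≠ 0 := by
    intro p hp h
    have h2 := Complex.slitPlane_ne_zero (K p hp).1
    simp only [ω] at h
    rw [Complex.cpow_eq_zero_iff] at h
    exact h2 h.1
  have Dg : ∀ p ∈ S, DifferentiableAt ℂ g p := by
    intro p hp
    have := Dω p hp
    have := ω0 p hp
    simp only [g]
    fun_prop (disch := assumption)
  have DP : ∀ p ∈ S, DifferentiableAt ℂ Pihat p := by
    intro p hp
    exact ((Dg p hp).const_add 1).inv (N1 p hp)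
  have DS : ∀ p ∈ S, DifferentiableAt ℂ Sighat p := fun p hp => (Dg p hp).mul (DP p hp)
  have z0 : ∀ p ∈ S, p.2 ≠ 0 := fun p hp => hp.2.1
  refine ⟨⟨s, hs0, A1⟩, ⟨⟨1 + s⁻¹, fun p hp => ⟨by linarith [A2 p hp], A3 p hp⟩⟩,
    fun p hp => (DP p hp).differentiableWithinAt, fun p hp => (DS p hp).differentiableWithinAt⟩,
    ?_, ?_⟩
  · set r := Real.sqrt (ε * Real.sin θ / 2) with hr
    have hr0 : 0 < r := Real.sqrt_pos.2 (by positivity)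
    have hr2 : r ^ 2 = ε * Real.sin θ / 2 := Real.sq_sqrt (by positivity)
    refine ⟨(1 + s⁻¹) + ((1 + s⁻¹) / r + 2 * a * s⁻¹), fun p hp => ?_⟩
    have hz := z0 p hp
    have e : Sighat p * (1 + p.2) / p.2 = Sighat p + Sighat p / p.2 := by
      field_simp
      ring
    rw [e]
    refine (norm_add_le _ _).trans (add_le_add (A3 p hp) ?_)
    have hP := A2 p hp
    have hsi : 0 < s⁻¹ := inv_pos.2 hs0
    rcases le_total r ‖p.2‖ with h | h
    · rw [norm_div]
      have : ‖Sighat p‖ / ‖p.2‖ ≤ (1 + s⁻¹) / r :=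
        div_le_div₀ (by positivity) (A3 p hp) hr0 h
      have : 0 ≤ 2 * a * s⁻¹ := by positivity
      linarith
    · have e2 : Sighat p / p.2 = a * (1 - p.2 / ω p) * Pihat p := by
        simp only [Sighat]
        rw [hg]
        field_simp
      have hωsq : ω p ^ 2 = (ε : ℂ) + p.1 + p.2 ^ 2 := by
        simp only [ω]
        rw [← Complex.cpow_nat_mul]
        norm_num
      have hz2 : ‖p.2‖ ^ 2 ≤ r ^ 2 := pow_le_pow_left₀ (norm_nonneg _) h 2
      have hle : ‖p.2‖ ≤ ‖ω p‖ := by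
        refine (pow_le_pow_iff_left₀ (norm_nonneg _) (norm_nonneg _) two_ne_zero).1 ?_
        rw [← norm_pow (ω p), hωsq]
        have t := norm_sub_le ((ε : ℂ) + p.1 + p.2 ^ 2) (p.2 ^ 2)
        rw [add_sub_cancel_right, norm_pow] at t
        linarith [(K p hp).2.2]
      have hdiv : ‖1 - p.2 / ω p‖ ≤ 2 := by
        refine (norm_sub_le _ _).trans ?_
        rw [norm_one, norm_div]
        linarith [div_le_one_of_le₀ hle (norm_nonneg _)]
      rw [e2, norm_mul, norm_mul, Complex.norm_real, Real.norm_of_nonneg ha.le]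
      have : a * ‖1 - p.2 / ω p‖ * ‖Pihat p‖ ≤ a * 2 * s⁻¹ := by gcongr
      have : 0 ≤ (1 + s⁻¹) / r := by positivity
      linarith
  · intro p hp
    have := DS p hp
    have := z0 p hp
    apply DifferentiableAt.differentiableWithinAt
    fun_prop (disch := assumption)
end

section
/- Let n ≥ 2 and let R > 0 be real. Let ζ ∈ ℝ^{n−1} with z := ‖ζ‖, let φ, β, β_v, β_w ∈ ℂ with φ ≠ 0 and φ + z² ≠ 0, and let τ_v ∈ ℂ^{n−1}, τ_w, h ∈ ℂ satisfy the boundary system (φ·I + ζζᵀ)τ_v = β_v·τ_w·(iζ) and β_w·i·⟪ζ, τ_v⟫ + β·τ_w = √R·h. Then ( β·(φ + z²) − β_v·β_w·z² )·τ_w = √R·(φ + z²)·h. -/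
/-- Solution of the Laplace–Fourier transformed boundary conditions for the Stokes
equations in the halfspace with the fully dynamic outflow condition (FDO):
from `(φI + ζζᵀ)τ_v = β_v τ_w (iζ)` and `β_w i⟪ζ,τ_v⟫ + β τ_w = √R h` one obtains
`(β(φ+z²) - β_v β_w z²) τ_w = √R (φ+z²) h`. -/
theorem fdo_boundary_symbol_solution (n : ℕ) (hn : 2 ≤ n) (R : ℝ) (hR : 0 < R)
    (ζ : EuclideanSpace ℝ (Fin (n - 1))) (φ β βv βw : ℂ)
    (τv : Fin (n - 1) → ℂ) (τw h : ℂ) :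
    let z : ℂ := (‖ζ‖ : ℂ)
    let ζc : Fin (n - 1) → ℂ := fun j => (ζ j : ℂ)
    φ ≠ 0 → φ + z ^ 2 ≠ 0 →
    (φ • (1 : Matrix (Fin (n - 1)) (Fin (n - 1)) ℂ)
        + Matrix.vecMulVec ζc ζc).mulVec τv
      = (fun j => βv * τw * (Complex.I * ζc j)) →
    βw * Complex.I * (∑ j, ζc j * τv j) + β * τw = (Real.sqrt R : ℂ) * h →
    (β * (φ + z ^ 2) - βv * βw * z ^ 2) * τw = (Real.sqrt R : ℂ) * (φ + z ^ 2) * h := by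
  intro z ζc _ _ h1 h2
  have hz : ∑ j, ζc j * ζc j = z ^ 2 := by
    have h3 : ‖ζ‖ ^ 2 = ∑ j, ζ j * ζ j := by
      rw [EuclideanSpace.real_norm_sq_eq]
      exact Finset.sum_congr rfl fun j _ => by ring
    simp only [z, ζc]
    exact_mod_cast h3.symm
  have hj : ∀ j, φ * τv j + ζc j * (∑ k, ζc k * τv k) = βv * τw * (Complex.I * ζc j) := by
    intro j
    have h3 := congrFun h1 j
    rw [Matrix.add_mulVec, Matrix.smul_mulVec, Matrix.one_mulVec] at h3
    simp only [Pi.add_apply, Pi.smul_apply, smul_eq_mul, Matrix.mulVec, dotProduct,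
      Matrix.vecMulVec_apply] at h3
    rw [← h3, Finset.mul_sum]
    simp only [mul_assoc]
  have hS : (φ + z ^ 2) * (∑ k, ζc k * τv k) = βv * τw * Complex.I * z ^ 2 := by
    generalize hT : (∑ k, ζc k * τv k) = S at hj ⊢
    have h4 : ∑ j, ζc j * (φ * τv j + ζc j * S)
        = ∑ j, ζc j * (βv * τw * (Complex.I * ζc j)) :=
      Finset.sum_congr rfl fun j _ => by rw [hj j]
    have h5 : ∑ j, ζc j * (φ * τv j + ζc j * S) = φ * S + z ^ 2 * S := by
      rw [← hz, ← hT, Finset.mul_sum, Finset.sum_mul, ← Finset.sum_add_distrib]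
      exact Finset.sum_congr rfl fun j _ => by ring
    have h6 : ∑ j, ζc j * (βv * τw * (Complex.I * ζc j)) = βv * τw * Complex.I * z ^ 2 := by
      rw [← hz, Finset.mul_sum]
      exact Finset.sum_congr rfl fun j _ => by ring
    rw [← h6, ← h4, h5]
    ring
  linear_combination (φ + z ^ 2) * h2 - βw * Complex.I * hS
    - βv * βw * z ^ 2 * τw * Complex.I_sq
end

section
/- Let 0 < θ < π/2 and let ε, α, β, μ > 0 be real. For λ ∈ Σ_{π−θ} and z ∈ Σ_{θ/2} set λ_ε := ε + λ and ω(λ,z) := √(λ_ε + μz²). Then λ_ε + μz² ∉ (−∞, 0], the denominator α√μ·λ_ε + β·ω(λ,z) never vanishes on Σ_{π−θ} × Σ_{θ/2}, and the two functions (λ,z) ↦ √μ·λ / (α√μ·λ_ε + β·ω(λ,z)) and (λ,z) ↦ √μ·z / (α√μ·λ_ε + β·ω(λ,z)) are bounded and holomorphic on the open set Σ_{π−θ} × Σ_{θ/2} ⊆ ℂ × ℂ. -/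
lemma dbp_L_le (v : ℂ) (φ : ℝ) : v.re * Real.cos φ + v.im * Real.sin φ ≤ ‖v‖ := by
  have h1 := Complex.norm_mul_cos_arg v
  have h2 := Complex.norm_mul_sin_arg v
  rw [← h1, ← h2]
  have h3 : ‖v‖ * Real.cos v.arg * Real.cos φ + ‖v‖ * Real.sin v.arg * Real.sin φ
      = ‖v‖ * Real.cos (v.arg - φ) := by rw [Real.cos_sub]; ring
  rw [h3]
  exact mul_le_of_le_one_right (norm_nonneg v) (Real.cos_le_one _)

lemma dbp_L_eq (v : ℂ) (φ : ℝ) :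
    v.re * Real.cos φ + v.im * Real.sin φ = ‖v‖ * Real.cos (v.arg - φ) := by
  rw [← Complex.norm_mul_cos_arg v, ← Complex.norm_mul_sin_arg v, Real.cos_sub]
  simp only [Complex.norm_mul_cos_arg, Complex.norm_mul_sin_arg]
  rw [mul_add, ← mul_assoc, ← mul_assoc, Complex.norm_mul_cos_arg, Complex.norm_mul_sin_arg]

lemma dbp_J_eq (v : ℂ) (θ : ℝ) :
    v.re * Real.sin θ + v.im * Real.cos θ = ‖v‖ * Real.sin (v.arg + θ) := by
  rw [Real.sin_add, mul_add, ← mul_assoc, ← mul_assoc, Complex.norm_mul_cos_arg,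
    Complex.norm_mul_sin_arg]
  ring

lemma dbp_arg_of_J (v : ℂ) (θ : ℝ) (hθ₀ : 0 < θ) (hθ₁ : θ < Real.pi / 2)
    (h : 0 < v.re * Real.sin θ + v.im * Real.cos θ) :
    v ≠ 0 ∧ -θ < v.arg ∧ v.arg < Real.pi - θ := by
  have hv : v ≠ 0 := by
    rintro rfl
    simp at h
  rw [dbp_J_eq] at h
  have hs : 0 < Real.sin (v.arg + θ) := by
    by_contra hc
    push Not at hc
    nlinarith [norm_nonneg v]
  have ha := Complex.neg_pi_lt_arg v
  have hb := Complex.arg_le_pi v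
  refine ⟨hv, ?_, ?_⟩
  · by_contra hc
    have := Real.sin_nonpos_of_nonpos_of_neg_pi_le (x := v.arg + θ) (by linarith) (by linarith)
    linarith
  · by_contra hc
    have := Real.sin_nonneg_of_nonneg_of_le_pi (x := v.arg + θ - Real.pi)
      (by linarith) (by linarith)
    rw [Real.sin_sub_pi] at this
    linarith

lemma dbp_cos_ge (θ x : ℝ) (hθ₀ : 0 < θ) (hx : |x| ≤ Real.pi / 2 - θ / 4) :
    Real.sin (θ / 4) ≤ Real.cos x := by
  rw [← Real.cos_pi_div_two_sub, ← Real.cos_abs x]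
  apply Real.cos_le_cos_of_nonneg_of_le_pi (abs_nonneg x) _ hx
  linarith [Real.pi_pos]

lemma dbp_core (θ ε A β μ : ℝ)
    (hθ₀ : 0 < θ) (hθ₁ : θ < Real.pi / 2) (hε : 0 < ε)
    (hA : 0 < A) (hβ : 0 < β) (hμ : 0 < μ) (l z : ℂ)
    (hl : l ∈ sector (Real.pi - θ)) (hz : z ∈ sector (θ / 2)) (hi : 0 ≤ l.im) :
    ((ε : ℂ) + l + (μ : ℂ) * z ^ 2 ∈ Complex.slitPlane) ∧
    Real.sin (θ / 4) * (A * ‖(ε : ℂ) + l‖ + β * Real.sqrt ‖(ε : ℂ) + l + (μ : ℂ) * z ^ 2‖) ≤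
      ‖(A : ℂ) * ((ε : ℂ) + l) + (β : ℂ) * ((ε : ℂ) + l + (μ : ℂ) * z ^ 2) ^ (1/2 : ℂ)‖ ∧
    Real.sin (θ / 4) * (‖l‖ + ε) ≤ ‖(ε : ℂ) + l‖ := by
  obtain ⟨hl0, hla⟩ := hl
  obtain ⟨hz0, hza⟩ := hz
  rw [abs_lt] at hla hza
  have hl1 : 0 ≤ l.arg := Complex.arg_nonneg_iff.2 hi
  have hJl : 0 < l.re * Real.sin θ + l.im * Real.cos θ := by
    rw [dbp_J_eq]
    exact mul_pos (norm_pos_iff.2 hl0) (Real.sin_pos_of_pos_of_lt_pi (by linarith) (by linarith))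
  have hsθ : 0 < Real.sin θ := Real.sin_pos_of_pos_of_lt_pi hθ₀ (by linarith)
  have hJz : 0 < (z ^ 2).re * Real.sin θ + (z ^ 2).im * Real.cos θ := by
    have e1 : (z ^ 2).re * Real.sin θ + (z ^ 2).im * Real.cos θ
        = ‖z‖ ^ 2 * Real.sin (2 * z.arg + θ) := by
      have hr : (z ^ 2).re = ‖z‖ ^ 2 * Real.cos (2 * z.arg) := by
        rw [Real.cos_two_mul', mul_sub, ← mul_pow, ← mul_pow, Complex.norm_mul_cos_arg,
          Complex.norm_mul_sin_arg]
        simp [pow_two]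
      have hm : (z ^ 2).im = ‖z‖ ^ 2 * Real.sin (2 * z.arg) := by
        have : ‖z‖ ^ 2 * Real.sin (2 * z.arg)
          = 2 * (‖z‖ * Real.sin z.arg) * (‖z‖ * Real.cos z.arg) := by
            rw [Real.sin_two_mul]; ring
        rw [this, Complex.norm_mul_cos_arg, Complex.norm_mul_sin_arg]
        simp [pow_two]; ring
      rw [hr, hm, Real.sin_add]; ring
    rw [e1]
    exact mul_pos (pow_pos (norm_pos_iff.2 hz0) 2)
      (Real.sin_pos_of_pos_of_lt_pi (by linarith) (by linarith))
  have hJe : 0 < ((ε : ℂ) + l).re * Real.sin θ + ((ε : ℂ) + l).im * Real.cos θ := by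
    simp only [Complex.add_re, Complex.add_im, Complex.ofReal_re, Complex.ofReal_im]
    nlinarith [mul_pos hε hsθ]
  have hJw : 0 < ((ε : ℂ) + l + (μ : ℂ) * z ^ 2).re * Real.sin θ
      + ((ε : ℂ) + l + (μ : ℂ) * z ^ 2).im * Real.cos θ := by
    rw [Complex.add_re, Complex.add_im, Complex.re_ofReal_mul, Complex.im_ofReal_mul]
    nlinarith [mul_pos hμ hJz]
  obtain ⟨he0, -, he2⟩ := dbp_arg_of_J _ θ hθ₀ hθ₁ hJe
  have he1 : 0 ≤ ((ε : ℂ) + l).arg := Complex.arg_nonneg_iff.2 (by simpa using hi)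
  obtain ⟨hw0, hw1, hw2⟩ := dbp_arg_of_J _ θ hθ₀ hθ₁ hJw
  set w := (ε : ℂ) + l + (μ : ℂ) * z ^ 2 with hw
  set e := (ε : ℂ) + l with he
  set φ : ℝ := Real.pi / 2 - 3 * θ / 4 with hφ
  refine ⟨Complex.mem_slitPlane_iff_arg.2 ⟨by linarith, hw0⟩, ?_, ?_⟩
  · refine le_trans ?_ (dbp_L_le _ φ)
    have hh : (1/2 : ℂ) = ((1/2 : ℝ) : ℂ) := by push_cast; rfl
    have e1 : ((A : ℂ) * e + (β : ℂ) * w ^ (1/2 : ℂ)).re * Real.cos φ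
        + ((A : ℂ) * e + (β : ℂ) * w ^ (1/2 : ℂ)).im * Real.sin φ
        = A * (‖e‖ * Real.cos (e.arg - φ))
          + β * (Real.sqrt ‖w‖ * Real.cos (w.arg * (1/2) - φ)) := by
      rw [Complex.add_re, Complex.add_im]
      simp only [Complex.re_ofReal_mul, Complex.im_ofReal_mul]
      rw [hh, Complex.cpow_ofReal_re, Complex.cpow_ofReal_im, ← dbp_L_eq, Real.sqrt_eq_rpow,
        Real.cos_sub (w.arg * (1/2))]
      ring
    rw [e1]
    have c1 : Real.sin (θ / 4) ≤ Real.cos (e.arg - φ) :=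
      dbp_cos_ge θ _ hθ₀ (abs_le.2 ⟨by linarith, by linarith⟩)
    have c2 : Real.sin (θ / 4) ≤ Real.cos (w.arg * (1/2) - φ) :=
      dbp_cos_ge θ _ hθ₀ (abs_le.2 ⟨by linarith, by linarith⟩)
    have d1 := mul_le_mul_of_nonneg_left c1 (mul_nonneg hA.le (norm_nonneg e))
    have d2 := mul_le_mul_of_nonneg_left c2 (mul_nonneg hβ.le (Real.sqrt_nonneg ‖w‖))
    linarith
  · refine le_trans ?_ (dbp_L_le _ φ)
    have e1 : e.re * Real.cos φ + e.im * Real.sin φ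
        = ε * Real.cos (0 - φ) + ‖l‖ * Real.cos (l.arg - φ) := by
      rw [← dbp_L_eq, zero_sub, Real.cos_neg, he]
      simp only [Complex.add_re, Complex.add_im, Complex.ofReal_re, Complex.ofReal_im]
      ring
    rw [e1]
    have c1 : Real.sin (θ / 4) ≤ Real.cos (l.arg - φ) :=
      dbp_cos_ge θ _ hθ₀ (abs_le.2 ⟨by linarith, by linarith⟩)
    have c2 : Real.sin (θ / 4) ≤ Real.cos (0 - φ) :=
      dbp_cos_ge θ _ hθ₀ (abs_le.2 ⟨by linarith, by linarith⟩)
    have d1 := mul_le_mul_of_nonneg_left c1 (norm_nonneg l)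
    have d2 := mul_le_mul_of_nonneg_left c2 hε.le
    linarith

lemma dbp_sector_conj (ψ : ℝ) (hψ : ψ < Real.pi) (v : ℂ) (hv : v ∈ sector ψ) :
    (starRingEnd ℂ) v ∈ sector ψ := by
  obtain ⟨h0, h1⟩ := hv
  refine ⟨by simpa using h0, ?_⟩
  have : v.arg ≠ Real.pi := by
    intro h
    rw [h, abs_of_pos Real.pi_pos] at h1
    linarith
  rw [Complex.arg_conj, if_neg this, abs_neg]
  exact h1

lemma dbp_all (θ ε A β μ : ℝ)
    (hθ₀ : 0 < θ) (hθ₁ : θ < Real.pi / 2) (hε : 0 < ε)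
    (hA : 0 < A) (hβ : 0 < β) (hμ : 0 < μ) (l z : ℂ)
    (hl : l ∈ sector (Real.pi - θ)) (hz : z ∈ sector (θ / 2)) :
    ((ε : ℂ) + l + (μ : ℂ) * z ^ 2 ∈ Complex.slitPlane) ∧
    Real.sin (θ / 4) * (A * ‖(ε : ℂ) + l‖ + β * Real.sqrt ‖(ε : ℂ) + l + (μ : ℂ) * z ^ 2‖) ≤
      ‖(A : ℂ) * ((ε : ℂ) + l) + (β : ℂ) * ((ε : ℂ) + l + (μ : ℂ) * z ^ 2) ^ (1/2 : ℂ)‖ ∧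
    Real.sin (θ / 4) * (‖l‖ + ε) ≤ ‖(ε : ℂ) + l‖ := by
  rcases le_total 0 l.im with hi | hi
  · exact dbp_core θ ε A β μ hθ₀ hθ₁ hε hA hβ hμ l z hl hz hi
  · obtain ⟨h1, h2, h3⟩ := dbp_core θ ε A β μ hθ₀ hθ₁ hε hA hβ hμ ((starRingEnd ℂ) l)
      ((starRingEnd ℂ) z)
      (dbp_sector_conj _ (by linarith) _ hl) (dbp_sector_conj _ (by linarith) _ hz)
      (by simpa using hi)
    have ee : (ε : ℂ) + (starRingEnd ℂ) l = (starRingEnd ℂ) ((ε : ℂ) + l) := by simp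
    have ew : (ε : ℂ) + (starRingEnd ℂ) l + (μ : ℂ) * (starRingEnd ℂ) z ^ 2
        = (starRingEnd ℂ) ((ε : ℂ) + l + (μ : ℂ) * z ^ 2) := by simp
    rw [ew] at h1 h2
    rw [ee] at h2 h3
    set w := (ε : ℂ) + l + (μ : ℂ) * z ^ 2 with hw
    have hs : w ∈ Complex.slitPlane := by
      rw [Complex.mem_slitPlane_iff] at h1 ⊢
      simpa using h1
    have ec : ((starRingEnd ℂ) w) ^ (1/2 : ℂ) = (starRingEnd ℂ) (w ^ (1/2 : ℂ)) := by
      rw [Complex.conj_cpow _ _ (Complex.mem_slitPlane_iff_arg.1 hs).1]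
      have h2c : (starRingEnd ℂ) (1/2 : ℂ) = 1/2 := by
        rw [map_div₀, map_one, Complex.conj_ofNat]
      rw [h2c]
    have ed : (A : ℂ) * (starRingEnd ℂ) ((ε : ℂ) + l) + (β : ℂ) * (starRingEnd ℂ) (w ^ (1/2 : ℂ))
        = (starRingEnd ℂ) ((A : ℂ) * ((ε : ℂ) + l) + (β : ℂ) * w ^ (1/2 : ℂ)) := by
      simp only [map_add, map_mul, Complex.conj_ofReal]
    rw [ec, ed] at h2
    simp only [Complex.norm_conj] at h2 h3
    exact ⟨hs, h2, h3⟩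

/-- The boundary symbols for the diffusion equation in the halfspace with the dynamic
boundary condition `α∂ₜu + β∂_νu = h`: with `λ_ε = ε + λ` and `ω = √(λ_ε + μz²)`, the
value `λ_ε + μz²` avoids `(-∞, 0]`, the denominator `α√μ·λ_ε + β·ω` never vanishes, and
`√μ·λ/(α√μ·λ_ε + βω)` and `√μ·z/(α√μ·λ_ε + βω)` are bounded and holomorphic on
`Σ_{π-θ} × Σ_{θ/2}`. -/
theorem dynamic_bc_parabolic_symbols (θ ε α β μ : ℝ)
    (hθ₀ : 0 < θ) (hθ₁ : θ < Real.pi / 2) (hε : 0 < ε)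
    (hα : 0 < α) (hβ : 0 < β) (hμ : 0 < μ) :
    let S : Set (ℂ × ℂ) := {p | p.1 ∈ sector (Real.pi - θ) ∧ p.2 ∈ sector (θ / 2)}
    let lε : ℂ × ℂ → ℂ := fun p => (ε : ℂ) + p.1
    let ω : ℂ × ℂ → ℂ := fun p => (lε p + (μ : ℂ) * p.2 ^ 2) ^ (1/2 : ℂ)
    let den : ℂ × ℂ → ℂ := fun p => (α : ℂ) * (Real.sqrt μ : ℂ) * lε p + (β : ℂ) * ω p
    let F₁ : ℂ × ℂ → ℂ := fun p => (Real.sqrt μ : ℂ) * p.1 / den p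
    let F₂ : ℂ × ℂ → ℂ := fun p => (Real.sqrt μ : ℂ) * p.2 / den p
    (∀ p ∈ S, lε p + (μ : ℂ) * p.2 ^ 2 ∈ Complex.slitPlane) ∧
    (∀ p ∈ S, den p ≠ 0) ∧
    (∃ C, ∀ p ∈ S, ‖F₁ p‖ ≤ C ∧ ‖F₂ p‖ ≤ C) ∧
    DifferentiableOn ℂ F₁ S ∧ DifferentiableOn ℂ F₂ S := by
  intro S lε ω den F₁ F₂
  have hm : 0 < Real.sqrt μ := Real.sqrt_pos.2 hμ
  have hA : 0 < α * Real.sqrt μ := mul_pos hα hm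
  have hc : 0 < Real.sin (θ / 4) :=
    Real.sin_pos_of_pos_of_lt_pi (by linarith) (by linarith)
  have key : ∀ p ∈ S, (lε p + (μ : ℂ) * p.2 ^ 2 ∈ Complex.slitPlane) ∧
      Real.sin (θ / 4) * (α * Real.sqrt μ * ‖lε p‖
        + β * Real.sqrt ‖lε p + (μ : ℂ) * p.2 ^ 2‖) ≤ ‖den p‖ ∧
      Real.sin (θ / 4) * (‖p.1‖ + ε) ≤ ‖lε p‖ := by
    intro p hp
    have := dbp_all θ ε (α * Real.sqrt μ) β μ hθ₀ hθ₁ hε hA hβ hμ p.1 p.2 hp.1 hp.2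
    rw [Complex.ofReal_mul] at this
    exact this
  generalize Real.sin (θ / 4) = c at hc key
  generalize hsm : Real.sqrt μ = m at *
  have hmm : m ^ 2 = μ := by rw [← hsm]; exact Real.sq_sqrt hμ.le
  have hden : ∀ p ∈ S, 0 < ‖den p‖ := by
    intro p hp
    obtain ⟨-, h2, h3⟩ := key p hp
    have h4 : 0 < ‖lε p‖ := lt_of_lt_of_le (by positivity) h3
    exact lt_of_lt_of_le (by positivity) h2
  have hden0 : ∀ p ∈ S, den p ≠ 0 := fun p hp => norm_pos_iff.1 (hden p hp)
  have dw : ∀ p ∈ S, DifferentiableWithinAt ℂ den S p := by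
    intro p hp
    apply DifferentiableAt.differentiableWithinAt
    have hsl := (key p hp).1
    have d1 : DifferentiableAt ℂ (fun q : ℂ × ℂ => lε q + (μ : ℂ) * q.2 ^ 2) p := by
      simp only [lε]; fun_prop
    have d2 : DifferentiableAt ℂ ω p := d1.cpow_const hsl
    have d3 : DifferentiableAt ℂ lε p := by simp only [lε]; fun_prop
    exact (d3.const_mul _).add (d2.const_mul _)
  refine ⟨fun p hp => (key p hp).1, hden0, ?_, ?_, ?_⟩
  · refine ⟨max (1 / (c * c * α)) (1 / (c * β) + 1 / (c * α * m * Real.sqrt (c * ε))),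
      fun p hp => ?_⟩
    obtain ⟨-, h2, h3⟩ := key p hp
    have hd := hden p hp
    set e := ‖lε p‖ with he
    set w := ‖lε p + (μ : ℂ) * p.2 ^ 2‖ with hw
    have e0 : 0 ≤ e := norm_nonneg _
    have w0 : 0 ≤ Real.sqrt w := Real.sqrt_nonneg _
    have hE : c * α * m * e ≤ ‖den p‖ := by
      have : 0 ≤ c * (β * Real.sqrt w) := by positivity
      linarith
    have hW : c * β * Real.sqrt w ≤ ‖den p‖ := by
      have : 0 ≤ c * (α * m * e) := by positivity
      linarith
    constructor
    · refine le_trans ?_ (le_max_left _ _)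
      simp only [F₁]
      rw [norm_div, norm_mul, Complex.norm_real, hsm, Real.norm_of_nonneg hm.le, div_le_div_iff₀ hd
        (by positivity), one_mul]
      have : c * ‖p.1‖ ≤ e := by nlinarith [mul_pos hc hε]
      have := mul_le_mul_of_nonneg_left this (by positivity : 0 ≤ c * α * m)
      nlinarith
    · refine le_trans ?_ (le_max_right _ _)
      simp only [F₂]
      rw [norm_div, norm_mul, Complex.norm_real, hsm, Real.norm_of_nonneg hm.le, div_le_iff₀ hd]
      have hs : 0 < Real.sqrt (c * ε) := Real.sqrt_pos.2 (by positivity)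
      have hce : c * ε ≤ e := by nlinarith [norm_nonneg p.1]
      have hse : Real.sqrt (c * ε) ≤ Real.sqrt e := Real.sqrt_le_sqrt hce
      have hee : Real.sqrt e * Real.sqrt e = e := Real.mul_self_sqrt e0
      have hww : Real.sqrt w * Real.sqrt w = w := Real.mul_self_sqrt (norm_nonneg _)
      have hz : μ * ‖p.2‖ ^ 2 ≤ w + e := by
        have := norm_sub_le (lε p + (μ : ℂ) * p.2 ^ 2) (lε p)
        rw [add_sub_cancel_left, norm_mul, norm_pow, Complex.norm_real,
          Real.norm_of_nonneg hμ.le] at this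
        exact this
      have hz2 : m * ‖p.2‖ ≤ Real.sqrt w + Real.sqrt e := by
        refine (sq_le_sq₀ (by positivity) (by positivity)).1 ?_
        rw [mul_pow, hmm]
        nlinarith [mul_nonneg w0 (Real.sqrt_nonneg e)]
      have hz3 : Real.sqrt w ≤ 1 / (c * β) * ‖den p‖ := by
        rw [one_div, ← div_eq_inv_mul, le_div_iff₀ (by positivity)]
        linarith
      have hz4 : Real.sqrt e ≤ 1 / (c * α * m * Real.sqrt (c * ε)) * ‖den p‖ := by
        rw [one_div, ← div_eq_inv_mul, le_div_iff₀ (by positivity)]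
        have : Real.sqrt e * Real.sqrt (c * ε) ≤ e := by
          nlinarith [mul_le_mul_of_nonneg_left hse (Real.sqrt_nonneg e)]
        have := mul_le_mul_of_nonneg_left this (by positivity : 0 ≤ c * α * m)
        linarith
      linarith
  · intro p hp
    have d1 : DifferentiableWithinAt ℂ (fun q : ℂ × ℂ => (Real.sqrt μ : ℂ) * q.1) S p := by
      fun_prop
    have d2 := d1.mul ((dw p hp).inv (hden0 p hp))
    simp only [F₁, div_eq_mul_inv]
    exact d2
  · intro p hp
    have d1 : DifferentiableWithinAt ℂ (fun q : ℂ × ℂ => (Real.sqrt μ : ℂ) * q.2) S p := by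
      fun_prop
    have d2 := d1.mul ((dw p hp).inv (hden0 p hp))
    simp only [F₂, div_eq_mul_inv]
    exact d2
end

section
/- Let n ≥ 2, R > 0, ξ ∈ ℝ^{n−1}, and set ζ := ξ/√R and z := ‖ζ‖. Let λ_ε, ω ∈ ℂ satisfy ω² = λ_ε + z², and let τ_v ∈ ℂ^{n−1}, τ_w ∈ ℂ. Define, for y ∈ ℝ: v̂(y) := e^{−√R·ω·y}·ω·τ_v − e^{−√R·z·y}·τ_w·(iζ) ∈ ℂ^{n−1}, ŵ(y) := e^{−√R·ω·y}·i·⟪ζ, τ_v⟫ + e^{−√R·z·y}·z·τ_w, and p̂(y) := e^{−√R·z·y}·(λ_ε/√R)·τ_w. Then for every y ∈ ℝ the transformed Stokes equations hold: ω²·v̂(y) − (1/R)·v̂''(y) + p̂(y)·(iξ) = 0 (as an identity in ℂ^{n−1}), ω²·ŵ(y) − (1/R)·ŵ''(y) + p̂'(y) = 0, and i·⟪ξ, v̂(y)⟫ + ŵ'(y) = 0, where ' denotes differentiation in y. -/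
theorem stokes_aux_deriv (a b A B : ℂ) :
    deriv (fun t : ℝ => Complex.exp (-(a * (t : ℂ))) * A + Complex.exp (-(b * (t : ℂ))) * B)
      = fun t : ℝ => Complex.exp (-(a * (t : ℂ))) * (-a * A)
          + Complex.exp (-(b * (t : ℂ))) * (-b * B) := by
  have key : ∀ (c : ℂ) (t : ℝ), HasDerivAt (fun t : ℝ => Complex.exp (-(c * (t : ℂ))))
      (Complex.exp (-(c * (t : ℂ))) * (-(c * 1))) t := by
    intro c t
    have h0 : HasDerivAt (fun t : ℝ => (t : ℂ)) 1 t := Complex.ofRealCLM.hasDerivAt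
    exact ((h0.const_mul c).neg).cexp
  funext t
  refine (((key a t).mul_const A).add ((key b t).mul_const B)).deriv.trans ?_
  ring

/-- The fundamental-solution ansatz solves the Laplace–Fourier transformed Stokes system
`∂ₜu - (1/R)Δu + ∇p = 0`, `div u = 0` in the halfspace: with `ζ = ξ/√R`, `z = ‖ζ‖`,
`ω² = λ_ε + z²`, the functions `v̂, ŵ, p̂` defined from boundary data `τ_v, τ_w` satisfy
the transformed momentum and divergence equations for every `y`. -/
theorem stokes_ansatz_solves_transformed_system (n : ℕ) (hn : 2 ≤ n) (R : ℝ) (hR : 0 < R)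
    (ξ ζ : EuclideanSpace ℝ (Fin (n - 1))) (hζ : ζ = (Real.sqrt R)⁻¹ • ξ)
    (lε ω : ℂ) (τv : Fin (n - 1) → ℂ) (τw : ℂ)
    (hω : ω ^ 2 = lε + (‖ζ‖ : ℂ) ^ 2) :
    let z : ℂ := (‖ζ‖ : ℂ)
    let e₁ : ℝ → ℂ := fun y => Complex.exp (-((Real.sqrt R : ℂ) * ω * (y : ℂ)))
    let e₂ : ℝ → ℂ := fun y => Complex.exp (-((Real.sqrt R : ℂ) * z * (y : ℂ)))
    let vhat : ℝ → Fin (n - 1) → ℂ := fun y j =>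
      e₁ y * ω * τv j - e₂ y * τw * (Complex.I * (ζ j : ℂ))
    let what : ℝ → ℂ := fun y =>
      e₁ y * (Complex.I * ∑ j, (ζ j : ℂ) * τv j) + e₂ y * z * τw
    let phat : ℝ → ℂ := fun y => e₂ y * (lε / (Real.sqrt R : ℂ)) * τw
    ∀ y : ℝ,
      (∀ j, ω ^ 2 * vhat y j - (1 / (R : ℂ)) * deriv (deriv fun t => vhat t j) y
          + phat y * (Complex.I * (ξ j : ℂ)) = 0) ∧
      (ω ^ 2 * what y - (1 / (R : ℂ)) * deriv (deriv what) y + deriv phat y = 0) ∧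
      (Complex.I * (∑ j, (ξ j : ℂ) * vhat y j) + deriv what y = 0) := by
  intro z e₁ e₂ vhat what phat y
  have hs0 : (Real.sqrt R : ℂ) ≠ 0 := by
    exact_mod_cast (Real.sqrt_pos.mpr hR).ne'
  have hsR : (R : ℂ) = (Real.sqrt R : ℂ) ^ 2 := by
    exact_mod_cast (Real.sq_sqrt hR.le).symm
  have hξ : ∀ j, (ξ j : ℂ) = (Real.sqrt R : ℂ) * (ζ j : ℂ) := by
    intro j
    have h : ζ j = (Real.sqrt R)⁻¹ * ξ j := by rw [hζ]; rfl
    rw [h]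
    push_cast
    field_simp
  have hz : ∑ j, (ζ j : ℂ) ^ 2 = z ^ 2 := by
    have := EuclideanSpace.real_norm_sq_eq ζ
    simp only [z]
    exact_mod_cast this.symm
  have hl : lε = ω ^ 2 - z ^ 2 := by rw [hω]; ring
  have hv : ∀ j, (fun t => vhat t j) = fun t : ℝ =>
      Complex.exp (-((Real.sqrt R : ℂ) * ω * (t : ℂ))) * (ω * τv j)
      + Complex.exp (-((Real.sqrt R : ℂ) * z * (t : ℂ))) * (-(τw * (Complex.I * (ζ j : ℂ)))) := by
    intro j; funext t; simp only [vhat, e₁, e₂]; ring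
  have hw : what = fun t : ℝ =>
      Complex.exp (-((Real.sqrt R : ℂ) * ω * (t : ℂ))) * (Complex.I * ∑ j, (ζ j : ℂ) * τv j)
      + Complex.exp (-((Real.sqrt R : ℂ) * z * (t : ℂ))) * (z * τw) := by
    funext t; simp only [what, e₁, e₂]; ring
  have hp : phat = fun t : ℝ =>
      Complex.exp (-((Real.sqrt R : ℂ) * ω * (t : ℂ))) * 0
      + Complex.exp (-((Real.sqrt R : ℂ) * z * (t : ℂ))) * (lε / (Real.sqrt R : ℂ) * τw) := by
    funext t; simp only [phat, e₂]; ring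
  clear_value z
  refine ⟨fun j => ?_, ?_, ?_⟩
  · have hvy := congrFun (hv j) y
    simp only at hvy
    rw [hvy, hv j, stokes_aux_deriv, stokes_aux_deriv, hp, hξ, hsR, hl]
    field_simp
    ring
  · rw [hw, hp, stokes_aux_deriv, stokes_aux_deriv, stokes_aux_deriv, hsR, hl]
    field_simp
    ring
  · have hsum : ∑ j, (ξ j : ℂ) * vhat y j
        = (Real.sqrt R : ℂ) * (e₁ y * ω * ∑ j, (ζ j : ℂ) * τv j)
          - (Real.sqrt R : ℂ) * (e₂ y * τw * Complex.I * ∑ j, (ζ j : ℂ) ^ 2) := by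
      simp only [Finset.mul_sum, ← Finset.sum_sub_distrib]
      refine Finset.sum_congr rfl fun j _ => ?_
      rw [hξ]
      simp only [vhat]
      ring
    rw [hsum, hw, stokes_aux_deriv, hz]
    simp only [e₁, e₂]
    ring_nf
    simp only [Complex.I_sq]
    ring
end
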